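/- Theorem 2 (JFT with lightly-noised first phase achieves SDP with amplified budget): let X be a type of datasets with the add-or-remove-one-token relation N_add and the F-neighbor relation N_F, let S be a type of sensitive-token collections with a relation N_s, let F' : X → S extract the sensitive tokens, and let Θ, Ω be measurable spaces. Assume: (i) A : S → Measure Θ is a first-phase mechanism (a Markov kernel) such that x ↦ A (F' x) satisfies (ε₁,δ₁)-differential privacy with respect to N_add (this is the guarantee of the noised optimizer at the amplified subsampling rate mM/N determined by the secret detector's miss rate m and batch size M); (ii) for every pair a, b with N_s a b there exist x, x' with N_add x x', F' x = a, and F' x' = b; (iii) N_F x x' implies N_s (F' x) (F' x'); (iv) M₂ : Θ → X → Measure Ω is a second-phase mechanism such that θ ↦ M₂ θ x is a Markov kernel for each x and, for every θ, the mechanism x ↦ M₂ θ x satisfies (ε₂,δ₂)-differential privacy with respect to N_F, where ε₁, ε₂ ≥ 0 and δ₁, δ₂ ≥ 0. Then the two-phase mechanism x ↦ (A (F' x)).bind (fun θ => M₂ θ x) satisfies (ε₁+ε₂, δ₁+δ₂)-differential privacy with respect to N_F. -/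

import Mathlib

open MeasureTheory ProbabilityTheory

/-- A mechanism `M : X → Measure Ω` satisfies `(ε, δ)`-differential privacy with respect
to a neighboring relation `N` on `X` if for all neighboring `x, x'` and every measurable
set `T`, `M x T ≤ exp ε * M x' T + δ`. -/
def IsDP {X : Type*} {Ω : Type*} [MeasurableSpace Ω] (M : X → Measure Ω)
    (N : X → X → Prop) (ε δ : ℝ) : Prop :=
  ∀ x x', N x x' → ∀ T : Set Ω, MeasurableSet T →
    M x T ≤ ENNReal.ofReal (Real.exp ε) * M x' T + ENNReal.ofReal δ

/-- An additive-multiplicative comparison of two measures on measurable sets extends to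
measurable functions bounded by one. -/
theorem lintegral_le_mul_lintegral_add_of_le_one {Θ : Type*} [MeasurableSpace Θ]
    {μ ν : Measure Θ} {c d : ENNReal}
    (h : ∀ T : Set Θ, MeasurableSet T → μ T ≤ c * ν T + d)
    {f : Θ → ENNReal} (hf : Measurable f) (hf_le : ∀ θ, f θ ≤ 1) :
    ∫⁻ θ, f θ ∂μ ≤ c * ∫⁻ θ, f θ ∂ν + d := by
  have layer_cake (ρ : Measure Θ) :
      ∫⁻ θ, f θ ∂ρ = ∫⁻ t in Set.Ioo (0 : ℝ) 1, ρ {θ | t < (f θ).toReal} := by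
    have hf_ofReal : ∫⁻ θ, f θ ∂ρ = ∫⁻ θ, ENNReal.ofReal (f θ).toReal ∂ρ :=
      lintegral_congr fun θ =>
        (ENNReal.ofReal_toReal ((hf_le θ).trans_lt ENNReal.one_lt_top).ne).symm
    rw [hf_ofReal, lintegral_eq_lintegral_meas_lt ρ
      (Filter.Eventually.of_forall fun _ => ENNReal.toReal_nonneg) hf.ennreal_toReal.aemeasurable]
    rw [← lintegral_indicator measurableSet_Ioi, ← lintegral_indicator measurableSet_Ioo]
    congr 1
    ext t
    by_cases ht : t ∈ Set.Ioo (0 : ℝ) 1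
    · rw [Set.indicator_of_mem ht, Set.indicator_of_mem (Set.mem_Ioi.mpr ht.1)]
    rw [Set.indicator_of_notMem ht, Set.indicator_apply_eq_zero]
    intro ht_pos
    have ht_one : 1 ≤ t := not_lt.mp fun hlt => ht ⟨ht_pos, hlt⟩
    have hempty : {θ | t < (f θ).toReal} = ∅ :=
      Set.eq_empty_of_forall_notMem fun θ hθ =>
        (ht_one.trans_lt hθ).not_ge (ENNReal.toReal_mono ENNReal.one_ne_top (hf_le θ))
    rw [hempty, measure_empty]
  have hmeas : Measurable fun t : ℝ => ν {θ | t < (f θ).toReal} :=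
    Antitone.measurable fun _ _ hst => measure_mono fun _ hθ => lt_of_le_of_lt hst hθ
  rw [layer_cake μ, layer_cake ν]
  calc
    ∫⁻ t in Set.Ioo (0 : ℝ) 1, μ {θ | t < (f θ).toReal}
        ≤ ∫⁻ t in Set.Ioo (0 : ℝ) 1, (c * ν {θ | t < (f θ).toReal} + d) :=
      lintegral_mono fun t => h _ (measurableSet_lt measurable_const hf.ennreal_toReal)
    _ = c * (∫⁻ t in Set.Ioo (0 : ℝ) 1, ν {θ | t < (f θ).toReal}) + d := by
      rw [lintegral_add_right _ measurable_const, lintegral_const_mul _ hmeas]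
      simp

/-- Theorem 2 (JFT with lightly-noised first phase achieves SDP with amplified budget).
`Nadd` is the add-or-remove-one-token relation on datasets, `NF` the `F`-neighbor relation,
`Ns` the relation on sensitive-token collections, and `F'` extracts the sensitive tokens.
If (i) the first-phase mechanism `x ↦ A (F' x)` is `(ε₁, δ₁)`-DP w.r.t. `Nadd` (the
amplified guarantee of the lightly-noised optimizer), (ii) every pair of `Ns`-neighbors is
the image under `F'` of a pair of `Nadd`-neighbors, (iii) `F'` maps `NF`-neighbors to
`Ns`-neighbors, and (iv) for every `θ` the second-phase mechanism `x ↦ M₂ x θ` is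
`(ε₂, δ₂)`-DP w.r.t. `NF`, then the two-phase mechanism
`x ↦ (A (F' x)).bind (M₂ x)` is `(ε₁ + ε₂, δ₁ + δ₂)`-DP w.r.t. `NF`. -/
theorem jft_amplified_achieves_sdp {X S : Type*} {Θ Ω : Type*}
    [MeasurableSpace S] [MeasurableSpace Θ] [MeasurableSpace Ω]
    (Nadd NF : X → X → Prop) (Ns : S → S → Prop) (F' : X → S)
    (ε₁ ε₂ δ₁ δ₂ : ℝ) (hε₁ : 0 ≤ ε₁) (hε₂ : 0 ≤ ε₂) (hδ₁ : 0 ≤ δ₁) (hδ₂ : 0 ≤ δ₂)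
    (A : Kernel S Θ) (hA : IsMarkovKernel A)
    (hDP₁ : IsDP (fun x => A (F' x)) Nadd ε₁ δ₁)
    (hsurj : ∀ a b : S, Ns a b → ∃ x x' : X, Nadd x x' ∧ F' x = a ∧ F' x' = b)
    (hF : ∀ x x', NF x x' → Ns (F' x) (F' x'))
    (M₂ : X → Kernel Θ Ω) (hM₂ : ∀ x, IsMarkovKernel (M₂ x))
    (hDP₂ : ∀ θ : Θ, IsDP (fun x => M₂ x θ) NF ε₂ δ₂) :
    IsDP (fun x => (A (F' x)).bind (M₂ x)) NF (ε₁ + ε₂) (δ₁ + δ₂) := by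
  intro x x' hx T hT
  obtain ⟨y, y', hy, hyx, hyx'⟩ := hsurj _ _ (hF x x' hx)
  have hA_le : ∀ U : Set Θ, MeasurableSet U →
      A (F' x) U ≤ ENNReal.ofReal (Real.exp ε₁) * A (F' x') U + ENNReal.ofReal δ₁ := by
    intro U hU
    simpa only [hyx, hyx'] using hDP₁ y y' hy U hU
  have hg : Measurable fun θ => M₂ x' θ T := (M₂ x').measurable_coe hT
  have hmin : Measurable fun θ => min 1 (ENNReal.ofReal (Real.exp ε₂) * M₂ x' θ T) :=
    measurable_const.min (hg.const_mul _)
  simp only [Measure.bind_apply hT (M₂ _).aemeasurable]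
  calc
    ∫⁻ θ, M₂ x θ T ∂A (F' x)
        ≤ ∫⁻ θ, (min 1 (ENNReal.ofReal (Real.exp ε₂) * M₂ x' θ T) + ENNReal.ofReal δ₂)
            ∂A (F' x) := by
      refine lintegral_mono fun θ => ?_
      rw [min_add]
      exact le_min (prob_le_one.trans le_self_add) (hDP₂ θ x x' hx T hT)
    _ = ∫⁻ θ, min 1 (ENNReal.ofReal (Real.exp ε₂) * M₂ x' θ T) ∂A (F' x)
          + ENNReal.ofReal δ₂ := by
      rw [lintegral_add_right _ measurable_const, lintegral_const, measure_univ, mul_one]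
    _ ≤ ENNReal.ofReal (Real.exp ε₁) *
            ∫⁻ θ, min 1 (ENNReal.ofReal (Real.exp ε₂) * M₂ x' θ T) ∂A (F' x')
          + ENNReal.ofReal δ₁ + ENNReal.ofReal δ₂ := by
      gcongr
      exact lintegral_le_mul_lintegral_add_of_le_one hA_le hmin fun _ => min_le_left _ _
    _ ≤ ENNReal.ofReal (Real.exp ε₁) *
            ∫⁻ θ, ENNReal.ofReal (Real.exp ε₂) * M₂ x' θ T ∂A (F' x')
          + ENNReal.ofReal δ₁ + ENNReal.ofReal δ₂ := by
      gcongr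
      exact min_le_right _ _
    _ = ENNReal.ofReal (Real.exp (ε₁ + ε₂)) * ∫⁻ θ, M₂ x' θ T ∂A (F' x')
          + ENNReal.ofReal (δ₁ + δ₂) := by
      rw [lintegral_const_mul _ hg, Real.exp_add, ENNReal.ofReal_mul (Real.exp_nonneg _),
        ENNReal.ofReal_add hδ₁ hδ₂, mul_assoc, add_assoc]
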